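/- arXiv:1211.2405 — 8 statements merged into one kernel-verified Lean document; each statement's English description precedes it below -/
import Mathlib

section
/- Let p be a real number with p > 2 and let n be a positive integer. Let A be the n×n real matrix with entries a_{ij} = 2p^{i+j} if j > i, a_{ij} = p^{2i} if j = i, and a_{ij} = 0 if j < i. Let y be any mixed strategy (y ∈ ℝⁿ with y_i ≥ 0 for all i and ∑_i y_i = 1) and let S = {j : y_j > 0} be its support. Then every pure best-response row to y lies in S; that is, for every i ∉ S there exists an index t with (Ay)_i < (Ay)_t. -/
open Matrix BigOperators

/-- The `n × n` payoff matrix of the paper, with `1`-based indices `i+1, j+1`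
for `i j : Fin n`: entry `2 p^{i+j}` above the diagonal, `p^{2i}` on the
diagonal, `0` below it. -/
noncomputable def gameA (p : ℝ) (n : ℕ) : Matrix (Fin n) (Fin n) ℝ :=
  fun i j =>
    if (i : ℕ) < (j : ℕ) then 2 * p ^ (((i : ℕ) + 1) + ((j : ℕ) + 1))
    else if (i : ℕ) = (j : ℕ) then p ^ (2 * ((i : ℕ) + 1))
    else 0

/-- A mixed strategy: nonnegative components summing to `1`. -/
def IsMixed {I : Type*} [Fintype I] (y : I → ℝ) : Prop :=
  (∀ i, 0 ≤ y i) ∧ ∑ i, y i = 1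

/-- `(x, y)` is a Nash equilibrium of the bimatrix game `(A, B)`. -/
def IsNash {I J : Type*} [Fintype I] [Fintype J]
    (A B : Matrix I J ℝ) (x : I → ℝ) (y : J → ℝ) : Prop :=
  IsMixed x ∧ IsMixed y ∧
  (∀ x' : I → ℝ, IsMixed x' → x' ⬝ᵥ A.mulVec y ≤ x ⬝ᵥ A.mulVec y) ∧
  (∀ y' : J → ℝ, IsMixed y' → x ⬝ᵥ B.mulVec y' ≤ x ⬝ᵥ B.mulVec y)

theorem gameA_nonneg {p : ℝ} (hp : 0 ≤ p) {n : ℕ} (i j : Fin n) : 0 ≤ gameA p n i j := by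
  unfold gameA
  split_ifs <;> positivity

theorem gameA_diag (p : ℝ) {n : ℕ} (i : Fin n) : gameA p n i i = p ^ (2 * ((i : ℕ) + 1)) := by
  simp [gameA]

theorem gameA_eq_zero_of_lt (p : ℝ) {n : ℕ} {i j : Fin n} (h : j < i) : gameA p n i j = 0 := by
  have h : (j : ℕ) < i := h
  simp [gameA, h.not_gt, h.ne']

/-- Above the diagonal, each column is dominated by its diagonal entry. -/
theorem gameA_lt_diag {p : ℝ} (hp : 2 < p) {n : ℕ} {i j : Fin n} (h : i < j) :
    gameA p n i j < gameA p n j j := by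
  have h : (i : ℕ) < j := h
  rw [gameA_diag]
  simp only [gameA, if_pos h]
  calc 2 * p ^ (((i : ℕ) + 1) + ((j : ℕ) + 1))
      < p * p ^ (((i : ℕ) + 1) + ((j : ℕ) + 1)) := by gcongr
    _ = p ^ (((i : ℕ) + 1) + ((j : ℕ) + 1) + 1) := by ring
    _ ≤ p ^ (2 * ((j : ℕ) + 1)) := pow_le_pow_right₀ (by linarith) (by omega)

/-- Above the diagonal, the entries of a column increase with the row. -/
theorem gameA_le_of_lt {p : ℝ} (hp : 1 ≤ p) {n : ℕ} {i t j : Fin n} (hit : i ≤ t) (htj : t < j) :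
    gameA p n i j ≤ gameA p n t j := by
  have hit' : (i : ℕ) ≤ t := hit
  have htj' : (t : ℕ) < j := htj
  simp only [gameA, if_pos htj', if_pos (hit'.trans_lt htj')]
  gcongr

/-- A nonzero strategy has a support element which, if the support meets the indices above `i`, is
the least support element above `i`. -/
theorem exists_support_next {n : ℕ} {y : Fin n → ℝ} (hy : ∃ j, 0 < y j) (i : Fin n) :
    ∃ t, 0 < y t ∧ ∀ j, i < j → 0 < y j → i < t ∧ t ≤ j := by
  classical
  by_cases h : ∃ j, i < j ∧ 0 < y j
  · obtain ⟨t, ht, hmin⟩ :=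
      ({j | i < j ∧ 0 < y j} : Finset (Fin n)).exists_min_image id (by simpa [Finset.Nonempty])
    simp only [Finset.mem_filter, Finset.mem_univ, true_and, id] at ht hmin
    exact ⟨t, ht.2, fun j hij hj => ⟨ht.1, hmin j ⟨hij, hj⟩⟩⟩
  · obtain ⟨t, ht⟩ := hy
    exact ⟨t, ht, fun j hij hj => absurd ⟨j, hij, hj⟩ h⟩

theorem stmt1 (p : ℝ) (hp : 2 < p) (n : ℕ) (hn : 0 < n)
    (y : Fin n → ℝ) (hy : IsMixed y) (i : Fin n) (hi : ¬ 0 < y i) :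
    ∃ t : Fin n, (gameA p n).mulVec y i < (gameA p n).mulVec y t := by
  obtain ⟨hy0, hy1⟩ := hy
  have hpos : ∃ j, 0 < y j := by
    by_contra! h
    linarith [Finset.sum_nonpos fun j (_ : j ∈ Finset.univ) => h j]
  obtain ⟨t, ht, hmin⟩ := exists_support_next hpos i
  have hti : t ≠ i := fun h => hi (h ▸ ht)
  simp only [mulVec, dotProduct]
  refine ⟨t, Finset.sum_lt_sum (fun j _ => ?_) ⟨t, Finset.mem_univ t, ?_⟩⟩
  · refine (hy0 j).eq_or_lt.elim (fun h => by simp [← h]) fun hj =>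
      mul_le_mul_of_nonneg_right ?_ hj.le
    rcases lt_trichotomy j i with h | rfl | h
    · rw [gameA_eq_zero_of_lt p h]
      exact gameA_nonneg (by linarith) t j
    · exact absurd hj hi
    · obtain ⟨hit, htj⟩ := hmin j h hj
      rcases htj.eq_or_lt with rfl | htj
      · exact (gameA_lt_diag hp hit).le
      · exact gameA_le_of_lt (by linarith) hit.le htj
  · refine mul_lt_mul_of_pos_right ?_ ht
    rcases hti.lt_or_gt with h | h
    · rw [gameA_eq_zero_of_lt p h, gameA_diag]
      positivity
    · exact gameA_lt_diag hp h
end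

section
/- Let p be a real number with p > 2 and let n be a positive integer. Let A be the n×n real matrix with entries a_{ij} = 2p^{i+j} if j > i, a_{ij} = p^{2i} if j = i, and a_{ij} = 0 if j < i, and let B = Aᵀ. Then the bimatrix game (A, B) is nondegenerate: for every mixed strategy y of the column player, the number of pure best-response rows to y (rows i maximizing (Ay)_i) is at most the size of the support of y, and for every mixed strategy x of the row player, the number of pure best-response columns to x (columns j maximizing (Bᵀx)_j = (Ax)_j) is at most the size of the support of x. -/
open Matrix BigOperators

/-- A bimatrix game `(A, B)` is nondegenerate: no mixed strategy of either
player has more pure best responses than the size of its support. -/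
def Nondegenerate {I J : Type*} [Fintype I] [Fintype J]
    (A B : Matrix I J ℝ) : Prop :=
  (∀ y : J → ℝ, IsMixed y →
    {i : I | ∀ k, A.mulVec y k ≤ A.mulVec y i}.ncard ≤ {j : J | 0 < y j}.ncard) ∧
  (∀ x : I → ℝ, IsMixed x →
    {j : J | ∀ k, Bᵀ.mulVec x k ≤ Bᵀ.mulVec x j}.ncard ≤ {i : I | 0 < x i}.ncard)

/-- The entries of `gameA` strictly to the right of the diagonal increase strictly when moving down
one row. -/
theorem gameA_lt_gameA_succ {p : ℝ} (hp : 2 < p) {n : ℕ} {i k j : Fin n}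
    (hk : (k : ℕ) = i + 1) (hj : i < j) : gameA p n i j < gameA p n k j := by
  have hij : (i : ℕ) < j := hj
  have hpos : ∀ m : ℕ, 0 < p ^ m := fun m => pow_pos (by linarith) m
  simp only [gameA, if_pos hij, hk]
  rcases (show (i : ℕ) + 1 < j ∨ (i : ℕ) + 1 = j by omega) with h | h
  · rw [if_pos h, show (i : ℕ) + 1 + 1 + (j + 1) = (i + 1 + (j + 1)) + 1 by ring, pow_succ]
    nlinarith [hpos (i + 1 + (j + 1))]
  · rw [if_neg h.not_lt, if_pos h,
      show 2 * ((i : ℕ) + 1 + 1) = (i + 1 + (j + 1)) + 1 by omega, pow_succ]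
    nlinarith [hpos (i + 1 + (j + 1))]

theorem gameA_of_lt {p : ℝ} {n : ℕ} {i j : Fin n} (h : j < i) : gameA p n i j = 0 := by
  have h' : (j : ℕ) < i := h
  simp only [gameA, if_neg h'.not_gt, if_neg h'.ne']

/-- A pure best response to a mixed strategy `y` lies in the support of `y`. -/
theorem pos_of_bestResponse_gameA {p : ℝ} (hp : 2 < p) {n : ℕ} {y : Fin n → ℝ} (hy : IsMixed y)
    {i : Fin n} (hi : ∀ k, (gameA p n).mulVec y k ≤ (gameA p n).mulVec y i) : 0 < y i := by
  obtain ⟨hy0, hy1⟩ := hy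
  have hp0 : 0 < p := by linarith
  by_contra hyi
  replace hyi : y i = 0 := le_antisymm (not_lt.mp hyi) (hy0 i)
  obtain ⟨k, -, hk⟩ : ∃ k ∈ Finset.univ, (0 : ℝ) < y k :=
    Finset.exists_lt_of_sum_lt (s := Finset.univ) (f := fun _ : Fin n => (0 : ℝ)) (by simp [hy1])
  have hterm : ∀ a j, 0 ≤ gameA p n a j * y j := fun a j =>
    mul_nonneg (gameA_nonneg hp0.le a j) (hy0 j)
  have hAk : 0 < (gameA p n).mulVec y k := by
    refine Finset.sum_pos' (fun j _ => hterm k j) ⟨k, Finset.mem_univ k, mul_pos ?_ hk⟩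
    simp only [gameA, lt_irrefl, if_false, if_true]
    positivity
  obtain ⟨j, -, hj⟩ : ∃ j ∈ Finset.univ, (0 : ℝ) < gameA p n i j * y j := by
    refine Finset.exists_lt_of_sum_lt (s := Finset.univ) (f := fun _ : Fin n => (0 : ℝ)) ?_
    rw [Finset.sum_const_zero]
    exact hAk.trans_le (hi k)
  have hyj : 0 < y j := (hy0 j).lt_of_ne fun h => by simp [← h] at hj
  have hij : i < j := by
    rcases lt_trichotomy i j with h | h | h
    · exact h
    · exact absurd hyi (h ▸ hyj.ne')
    · simp [gameA_of_lt h] at hj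
  have hi1 : (i : ℕ) + 1 < n := lt_of_le_of_lt (Nat.succ_le_of_lt hij) j.isLt
  refine (hi ⟨i + 1, hi1⟩).not_gt ?_
  simp only [Matrix.mulVec, dotProduct]
  refine Finset.sum_lt_sum (fun l _ => ?_) ⟨j, Finset.mem_univ j,
    mul_lt_mul_of_pos_right (gameA_lt_gameA_succ hp rfl hij) hyj⟩
  rcases lt_trichotomy i l with h | h | h
  · exact mul_le_mul_of_nonneg_right (gameA_lt_gameA_succ hp rfl h).le (hy0 l)
  · simp [← h, hyi]
  · simpa [gameA_of_lt h] using hterm _ l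

theorem stmt2 (p : ℝ) (hp : 2 < p) (n : ℕ) (hn : 0 < n) :
    Nondegenerate (gameA p n) (gameA p n)ᵀ := by
  rw [_root_.Nondegenerate, Matrix.transpose_transpose, and_self]
  exact fun y hy => Set.ncard_le_ncard fun i hi => pos_of_bestResponse_gameA hp hy hi
end

section
/- Let p be a real number with p > 2 and let n be a positive integer. Let A be the n×n real matrix with entries a_{ij} = 2p^{i+j} if j > i, a_{ij} = p^{2i} if j = i, and a_{ij} = 0 if j < i. Then for every nonempty subset S of {1, …, n} there exists a mixed strategy y whose support is exactly S such that (y, y) is a Nash equilibrium of the bimatrix game (A, Aᵀ). -/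
open Matrix BigOperators

/-- Weights supported exactly on `S` that solve the rescaled indifference system with
right-hand sides `c * q ^ i`. -/
lemma exists_weights {q : ℝ} (hq : 0 < q) (hq2 : 2 * q < 1) :
    ∀ (n : ℕ) (c : ℝ), 0 < c → ∀ S : Fin n → Prop,
      ∃ z : Fin n → ℝ, (∀ i, 0 ≤ z i) ∧ (∀ i, 0 < z i ↔ S i) ∧ ∑ i, z i ≤ c ∧
        (∀ i, ∑ j, (if i < j then 2 else if i = j then 1 else 0) * z j ≤ c * q ^ (i : ℕ)) ∧
        (∀ i, S i →
          ∑ j, (if i < j then 2 else if i = j then 1 else 0) * z j = c * q ^ (i : ℕ)) := by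
  classical
  intro n
  induction n with
  | zero =>
    intro c hc S
    exact ⟨fun _ => 0, fun i => i.elim0, fun i => i.elim0, by simpa using hc.le,
      fun i => i.elim0, fun i => i.elim0⟩
  | succ n ih =>
    intro c hc S
    obtain ⟨z, hz, hzS, hsum, hle, heq⟩ := ih (c * q) (by positivity) fun i => S i.succ
    have hT : 0 ≤ ∑ i, z i := Finset.sum_nonneg fun i _ => hz i
    have hlt : 2 * ∑ i, z i < c := by nlinarith
    have hpow : ∀ i : Fin n, c * q * q ^ (i : ℕ) = c * q ^ ((i.succ : Fin (n + 1)) : ℕ) := by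
      intro i
      rw [Fin.val_succ, pow_succ]
      ring
    refine ⟨Fin.cons (if S 0 then c - 2 * ∑ i, z i else 0) z, ?_, ?_, ?_, ?_, ?_⟩
    · refine Fin.cases ?_ fun i => ?_
      · rw [Fin.cons_zero]
        split_ifs <;> linarith
      · simpa using hz i
    · refine Fin.cases ?_ fun i => ?_
      · rw [Fin.cons_zero]
        split_ifs with h
        · exact ⟨fun _ => h, fun _ => by linarith⟩
        · simp [h]
      · simpa using hzS i
    · rw [Fin.sum_univ_succ]
      simp only [Fin.cons_zero, Fin.cons_succ]
      split_ifs <;> linarith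
    · refine Fin.cases ?_ fun i => ?_
      · rw [Fin.sum_univ_succ]
        simp only [Fin.cons_zero, Fin.cons_succ, Fin.succ_pos, lt_irrefl, if_true, if_false,
          ← Finset.mul_sum, Fin.val_zero, pow_zero]
        split_ifs <;> linarith
      · rw [Fin.sum_univ_succ, ← hpow]
        simpa [Fin.succ_ne_zero] using hle i
    · refine Fin.cases (fun h => ?_) fun i h => ?_
      · rw [Fin.sum_univ_succ]
        simp only [Fin.cons_zero, Fin.cons_succ, Fin.succ_pos, lt_irrefl, if_true, if_false,
          ← Finset.mul_sum, Fin.val_zero, pow_zero, h]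
        ring
      · rw [Fin.sum_univ_succ, ← hpow]
        simpa [Fin.succ_ne_zero] using heq i h

/-- If every pure strategy earns at most `v` against `y`, with equality on the support of `y`,
then `(y, y)` is an equilibrium of `(A, Aᵀ)`. -/
lemma isNash_transpose_of_best_response {I : Type*} [Fintype I] {A : Matrix I I ℝ} {y : I → ℝ}
    {v : ℝ} (hy : IsMixed y) (hle : ∀ i, A.mulVec y i ≤ v)
    (heq : ∀ i, 0 < y i → A.mulVec y i = v) : IsNash A Aᵀ y y := by
  have hval : y ⬝ᵥ A.mulVec y = v := by
    calc y ⬝ᵥ A.mulVec y = ∑ i, y i * v := by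
          refine Finset.sum_congr rfl fun i _ => ?_
          rcases (hy.1 i).eq_or_lt with h | h
          · simp [← h]
          · rw [heq i h]
      _ = v := by rw [← Finset.sum_mul, hy.2, one_mul]
  have hbest : ∀ x : I → ℝ, IsMixed x → x ⬝ᵥ A.mulVec y ≤ y ⬝ᵥ A.mulVec y := by
    intro x hx
    rw [hval]
    calc x ⬝ᵥ A.mulVec y ≤ ∑ i, x i * v :=
          Finset.sum_le_sum fun i _ => mul_le_mul_of_nonneg_left (hle i) (hx.1 i)
      _ = v := by rw [← Finset.sum_mul, hx.2, one_mul]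
  have hswap : ∀ x : I → ℝ, y ⬝ᵥ Aᵀ.mulVec x = x ⬝ᵥ A.mulVec y := by
    intro x
    rw [Matrix.mulVec_transpose, dotProduct_comm, ← Matrix.dotProduct_mulVec]
  refine ⟨hy, hy, hbest, fun x hx => ?_⟩
  rw [hswap, hswap]
  exact hbest x hx

/-- Dividing the `j`-th weight by `p ^ (j + 1)` reduces `gameA` to the matrix with entries
`2`, `1`, `0` above, on and below the diagonal. -/
lemma gameA_mulVec_smul {p : ℝ} (hp : p ≠ 0) {n : ℕ} (s : ℝ) (z : Fin n → ℝ) (i : Fin n) :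
    (gameA p n).mulVec (fun j => s * (p⁻¹ ^ ((j : ℕ) + 1) * z j)) i =
      s * (p ^ ((i : ℕ) + 1) *
        ∑ j, (if i < j then 2 else if i = j then 1 else 0) * z j) := by
  simp only [Matrix.mulVec, dotProduct, gameA, Finset.mul_sum]
  refine Finset.sum_congr rfl fun j _ => ?_
  have hcancel : p ^ ((j : ℕ) + 1) * p⁻¹ ^ ((j : ℕ) + 1) = 1 := by
    rw [← mul_pow, mul_inv_cancel₀ hp, one_pow]
  rcases lt_trichotomy i j with h | h | h
  · rw [if_pos (Fin.lt_def.mp h), if_pos h, pow_add]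
    linear_combination (2 * p ^ ((i : ℕ) + 1) * s * z j) * hcancel
  · subst h
    simp only [lt_irrefl, if_true, if_false, two_mul, pow_add p ((i : ℕ) + 1)]
    linear_combination (p ^ ((i : ℕ) + 1) * s * z i) * hcancel
  · have h' : (j : ℕ) < i := h
    simp [h.not_gt, h.ne', h'.not_gt, h'.ne']

theorem stmt4 (p : ℝ) (hp : 2 < p) (n : ℕ) (hn : 0 < n)
    (S : Finset (Fin n)) (hS : S.Nonempty) :
    ∃ y : Fin n → ℝ, IsMixed y ∧ {j : Fin n | 0 < y j} = (S : Set (Fin n)) ∧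
      IsNash (gameA p n) (gameA p n)ᵀ y y := by
  have hp0 : 0 < p := by linarith
  have hq : 0 < p⁻¹ := inv_pos.mpr hp0
  have hpq : p * p⁻¹ = 1 := mul_inv_cancel₀ hp0.ne'
  obtain ⟨z, hz, hzS, -, hle, heq⟩ :=
    exists_weights hq (by nlinarith) n p⁻¹ hq fun i => i ∈ S
  have hw : ∀ j : Fin n, 0 ≤ p⁻¹ ^ ((j : ℕ) + 1) * z j :=
    fun j => mul_nonneg (by positivity) (hz j)
  have hsum : 0 < ∑ j : Fin n, p⁻¹ ^ ((j : ℕ) + 1) * z j := by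
    obtain ⟨k, hk⟩ := hS
    exact Finset.sum_pos' (fun j _ => hw j)
      ⟨k, Finset.mem_univ k, mul_pos (by positivity) ((hzS k).mpr hk)⟩
  set s := (∑ j : Fin n, p⁻¹ ^ ((j : ℕ) + 1) * z j)⁻¹ with hs
  have hs0 : 0 < s := inv_pos.mpr hsum
  have hpos : ∀ j : Fin n, 0 < s * (p⁻¹ ^ ((j : ℕ) + 1) * z j) ↔ j ∈ S := by
    intro j
    rw [mul_pos_iff_of_pos_left hs0, mul_pos_iff_of_pos_left (by positivity), hzS]
  have hmixed : IsMixed fun j : Fin n => s * (p⁻¹ ^ ((j : ℕ) + 1) * z j) :=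
    ⟨fun j => mul_nonneg hs0.le (hw j), by
      rw [← Finset.mul_sum, hs, inv_mul_cancel₀ hsum.ne']⟩
  have hone : ∀ i : Fin n, p ^ ((i : ℕ) + 1) * (p⁻¹ * p⁻¹ ^ (i : ℕ)) = 1 := by
    intro i
    rw [← pow_succ', ← mul_pow, hpq, one_pow]
  refine ⟨_, hmixed, Set.ext hpos, isNash_transpose_of_best_response (v := s) hmixed ?_ ?_⟩
  · intro i
    rw [gameA_mulVec_smul hp0.ne']
    exact mul_le_of_le_one_right hs0.le
      ((mul_le_mul_of_nonneg_left (hle i) (by positivity)).trans_eq (hone i))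
  · intro i hi
    rw [gameA_mulVec_smul hp0.ne', heq i ((hpos i).mp hi), hone, mul_one]
end

section
/- Let p be a real number with p > 2 and let n be a positive integer. Let A be the n×n real matrix with entries a_{ij} = 2p^{i+j} if j > i, a_{ij} = p^{2i} if j = i, and a_{ij} = 0 if j < i. Then every Nash equilibrium (x, y) of the bimatrix game (A, Aᵀ) is symmetric, i.e. x = y; moreover, for each nonempty subset S of {1, …, n} there is exactly one Nash equilibrium (y, y) whose strategies have support S. -/
open Matrix BigOperators

theorem gameA_mulVec (p : ℝ) (n : ℕ) (y : Fin n → ℝ) (i : Fin n) :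
    (gameA p n).mulVec y i = p ^ ((i : ℕ) + 1) *
      (p ^ ((i : ℕ) + 1) * y i + 2 * ∑ j ∈ Finset.Ioi i, p ^ ((j : ℕ) + 1) * y j) := by
  have key : ∀ j : Fin n, gameA p n i j * y j = p ^ ((i : ℕ) + 1) *
      ((if i = j then p ^ ((i : ℕ) + 1) * y i else 0) +
        2 * (if i < j then p ^ ((j : ℕ) + 1) * y j else 0)) := by
    intro j
    rcases lt_trichotomy i j with h | h | h
    · have h' : (i : ℕ) < j := h
      simp only [gameA, h', h, h.ne, if_true, if_false]
      ring
    · subst h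
      simp only [gameA, lt_irrefl, if_true, if_false]
      ring
    · have h' : ¬ (i : ℕ) < j := not_lt_of_gt h
      have h'' : ¬ (i : ℕ) = j := fun e => h.ne' (Fin.ext e)
      simp only [gameA, h', h'', h.ne', not_lt_of_gt h, if_false]
      ring
  have hI : Finset.Ioi i = Finset.univ.filter (fun j => i < j) := by
    ext j; simp
  simp only [Matrix.mulVec, dotProduct, key]
  rw [← Finset.mul_sum, Finset.sum_add_distrib, ← Finset.mul_sum, Finset.sum_ite_eq, hI,
    Finset.sum_filter]
  simp

theorem two_mul_pow_lt {p : ℝ} (hp : 2 < p) {a b : ℕ} (h : a < b) :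
    2 * p ^ (a + 1) < p ^ (b + 1) := by
  have h1 : (0 : ℝ) < p ^ (a + 1) := by positivity
  calc 2 * p ^ (a + 1) < p * p ^ (a + 1) := by gcongr
    _ = p ^ (a + 1 + 1) := by ring
    _ ≤ p ^ (b + 1) := pow_le_pow_right₀ (by linarith) (by omega)

theorem gameA_mulVec_pos {p : ℝ} (hp : 2 < p) {n : ℕ} {y : Fin n → ℝ} (hy : ∀ i, 0 ≤ y i)
    {i : Fin n} (hi : 0 < y i) : 0 < (gameA p n).mulVec y i := by
  rw [gameA_mulVec]
  have h1 : 0 ≤ ∑ j ∈ Finset.Ioi i, p ^ ((j : ℕ) + 1) * y j :=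
    Finset.sum_nonneg fun j _ => mul_nonneg (by positivity) (hy j)
  positivity

/-- A pure strategy that is not played by the opponent is strictly worse than some pure strategy
that the opponent does play. -/
theorem exists_gameA_mulVec_lt {p : ℝ} (hp : 2 < p) {n : ℕ} {y : Fin n → ℝ}
    (hy : ∀ i, 0 ≤ y i) {m : Fin n} (hm : 0 < y m) {i : Fin n} (hi : y i = 0) :
    ∃ k, 0 < y k ∧ (gameA p n).mulVec y i < (gameA p n).mulVec y k := by
  by_cases h : ∃ j, i < j ∧ 0 < y j
  · obtain ⟨k, ⟨hik, hk⟩, hmin⟩ := WellFounded.has_min (wellFounded_lt (α := Fin n))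
      {j | i < j ∧ 0 < y j} h
    refine ⟨k, hk, ?_⟩
    have hsum : ∑ j ∈ Finset.Ioi i, p ^ ((j : ℕ) + 1) * y j
        = p ^ ((k : ℕ) + 1) * y k + ∑ j ∈ Finset.Ioi k, p ^ ((j : ℕ) + 1) * y j := by
      rw [← Finset.sum_insert (s := Finset.Ioi k) (a := k)
        (f := fun j : Fin n => p ^ ((j : ℕ) + 1) * y j) (by simp)]
      symm
      apply Finset.sum_subset
      · intro j hj
        simp only [Finset.mem_insert, Finset.mem_Ioi] at hj ⊢
        rcases hj with rfl | hj
        · exact hik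
        · exact hik.trans hj
      · intro j hj hj'
        simp only [Finset.mem_insert, Finset.mem_Ioi, not_or, not_lt] at hj hj'
        have : y j = 0 := by
          by_contra hne
          exact hmin j ⟨hj, lt_of_le_of_ne (hy j) (Ne.symm hne)⟩
            (lt_of_le_of_ne hj'.2 hj'.1)
        simp [this]
    rw [gameA_mulVec, gameA_mulVec, hsum, hi]
    have h1 : 0 ≤ ∑ j ∈ Finset.Ioi k, p ^ ((j : ℕ) + 1) * y j :=
      Finset.sum_nonneg fun j _ => mul_nonneg (by positivity) (hy j)
    have h2 := two_mul_pow_lt hp (show (i : ℕ) < k from hik)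
    have h3 : (0 : ℝ) < p ^ ((i : ℕ) + 1) := by positivity
    have h4 : (0 : ℝ) < p ^ ((k : ℕ) + 1) * y k := by positivity
    generalize ∑ j ∈ Finset.Ioi k, p ^ ((j : ℕ) + 1) * y j = Z at *
    generalize p ^ ((k : ℕ) + 1) * y k = z at *
    have h5 : 0 < (p ^ ((k : ℕ) + 1) - 2 * p ^ ((i : ℕ) + 1)) * (z + 2 * Z) :=
      mul_pos (by linarith) (by linarith)
    have h6 : 0 ≤ p ^ ((i : ℕ) + 1) * Z := by positivity
    nlinarith
  · push Not at h
    refine ⟨m, hm, ?_⟩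
    have h0 : (gameA p n).mulVec y i = 0 := by
      rw [gameA_mulVec, hi, Finset.sum_eq_zero]
      · simp
      · intro j hj
        rw [le_antisymm (h j (Finset.mem_Ioi.1 hj)) (hy j), mul_zero]
    rw [h0]
    exact gameA_mulVec_pos hp hy hm

theorem eq_zero_of_gameA_mulVec_eq_zero {p : ℝ} (hp : 2 < p) {n : ℕ} {d : Fin n → ℝ}
    (h : ∀ i, d i ≠ 0 → (gameA p n).mulVec d i = 0) : d = 0 := by
  by_contra hne
  obtain ⟨j, hj⟩ := Function.ne_iff.1 hne
  obtain ⟨i, hi, hmax⟩ := WellFounded.has_min (wellFounded_gt (α := Fin n))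
    {j | d j ≠ 0} ⟨j, hj⟩
  have h1 := h i hi
  rw [gameA_mulVec, Finset.sum_eq_zero] at h1
  · have h2 : p ^ ((i : ℕ) + 1) ≠ 0 := by positivity
    simp_all
  · intro j hj
    have : d j = 0 := by
      by_contra hne
      exact hmax j hne (Finset.mem_Ioi.1 hj)
    simp [this]

theorem IsMixed.exists_pos {I : Type*} [Fintype I] {x : I → ℝ} (hx : IsMixed x) :
    ∃ i, 0 < x i := by
  by_contra! h
  have : ∑ i, x i ≤ 0 := Finset.sum_nonpos fun i _ => h i
  linarith [hx.2]

/-- Mixed strategies with equal supports, each equalizing the payoffs on the support, coincide. -/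
theorem eq_of_gameA_mulVec_const {p : ℝ} (hp : 2 < p) {n : ℕ} {x y : Fin n → ℝ}
    (hx : IsMixed x) (hy : IsMixed y) (hxy : ∀ i, 0 < x i ↔ 0 < y i) {v w : ℝ}
    (hv : ∀ i, 0 < x i → (gameA p n).mulVec y i = v)
    (hw : ∀ i, 0 < y i → (gameA p n).mulVec x i = w) : x = y := by
  have hd : w • y - v • x = 0 := by
    refine eq_zero_of_gameA_mulVec_eq_zero hp fun i hi => ?_
    have hxi : 0 < x i := by
      by_contra h
      have h1 : x i = 0 := le_antisymm (not_lt.1 h) (hx.1 i)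
      have h2 : y i = 0 := le_antisymm (not_lt.1 fun h' => h ((hxy i).2 h')) (hy.1 i)
      exact hi (by simp [h1, h2])
    simp [Matrix.mulVec_sub, Matrix.mulVec_smul, hv i hxi, hw i ((hxy i).1 hxi), mul_comm]
  have hpt : ∀ i, w * y i = v * x i := fun i => by
    have := congrFun hd i
    simp only [Pi.sub_apply, Pi.smul_apply, smul_eq_mul, Pi.zero_apply] at this
    linarith
  have hvw : w = v := by
    have : ∑ i, w * y i = ∑ i, v * x i := Finset.sum_congr rfl fun i _ => hpt i
    rwa [← Finset.mul_sum, ← Finset.mul_sum, hx.2, hy.2, mul_one, mul_one] at this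
  obtain ⟨m, hm⟩ := hy.exists_pos
  have hw0 : 0 < w := hw m hm ▸ gameA_mulVec_pos hp hx.1 ((hxy m).2 hm)
  funext i
  have := hpt i
  rw [← hvw] at this
  exact (mul_left_cancel₀ hw0.ne' this).symm

/-- Best response condition. -/
theorem forall_isMixed_dotProduct_le_iff {I : Type*} [Fintype I] {x : I → ℝ} (hx : IsMixed x)
    (u : I → ℝ) : (∀ x', IsMixed x' → x' ⬝ᵥ u ≤ x ⬝ᵥ u) ↔
      ∃ c, (∀ i, u i ≤ c) ∧ ∀ i, 0 < x i → u i = c := by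
  classical
  constructor
  · intro h
    have hle : ∀ i, u i ≤ x ⬝ᵥ u := fun i => by
      have := h (Pi.single i 1) ⟨fun j => by
        by_cases hj : j = i
        · subst hj; simp
        · simp [hj], by simp⟩
      simpa using this
    refine ⟨x ⬝ᵥ u, hle, fun i hi => ?_⟩
    have hsum : ∑ j, x j * (x ⬝ᵥ u - u j) = 0 := by
      simp only [mul_sub, Finset.sum_sub_distrib, ← Finset.sum_mul, hx.2, one_mul]
      exact sub_self _
    have := (Finset.sum_eq_zero_iff_of_nonneg fun j _ =>
      mul_nonneg (hx.1 j) (sub_nonneg.2 (hle j))).1 hsum i (Finset.mem_univ i)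
    rcases mul_eq_zero.1 this with h0 | h0
    · exact absurd h0 hi.ne'
    · linarith
  · rintro ⟨c, hle, heq⟩ x' hx'
    have h1 : x ⬝ᵥ u = c := by
      calc x ⬝ᵥ u = ∑ i, x i * c := Finset.sum_congr rfl fun i _ => by
            rcases (hx.1 i).eq_or_lt with h0 | h0
            · simp [← h0]
            · rw [heq i h0]
        _ = c := by rw [← Finset.sum_mul, hx.2, one_mul]
    calc x' ⬝ᵥ u ≤ ∑ i, x' i * c :=
          Finset.sum_le_sum fun i _ => mul_le_mul_of_nonneg_left (hle i) (hx'.1 i)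
      _ = x ⬝ᵥ u := by rw [← Finset.sum_mul, hx'.2, one_mul, h1]

theorem isNash_transpose_iff {I : Type*} [Fintype I] (A : Matrix I I ℝ) (x y : I → ℝ) :
    IsNash A Aᵀ x y ↔ IsMixed x ∧ IsMixed y ∧
      (∃ v, (∀ i, A.mulVec y i ≤ v) ∧ ∀ i, 0 < x i → A.mulVec y i = v) ∧
      (∃ w, (∀ i, A.mulVec x i ≤ w) ∧ ∀ i, 0 < y i → A.mulVec x i = w) := by
  have hT : ∀ z, x ⬝ᵥ Aᵀ.mulVec z = z ⬝ᵥ A.mulVec x := fun z => by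
    rw [Matrix.dotProduct_mulVec, Matrix.vecMul_transpose, dotProduct_comm]
  simp only [IsNash, hT]
  refine and_congr_right fun hx => and_congr_right fun hy => ?_
  rw [forall_isMixed_dotProduct_le_iff hx, forall_isMixed_dotProduct_le_iff hy]

theorem pos_of_gameA_best_response {p : ℝ} (hp : 2 < p) {n : ℕ} {x y : Fin n → ℝ}
    (hy : IsMixed y) {v : ℝ} (hle : ∀ i, (gameA p n).mulVec y i ≤ v)
    (heq : ∀ i, 0 < x i → (gameA p n).mulVec y i = v) {i : Fin n} (hi : 0 < x i) : 0 < y i := by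
  by_contra h
  obtain ⟨m, hm⟩ := hy.exists_pos
  obtain ⟨k, -, hk⟩ := exists_gameA_mulVec_lt hp hy.1 hm (le_antisymm (not_lt.1 h) (hy.1 i))
  linarith [hle k, heq i hi]

theorem exists_gameA_equalizing {p : ℝ} (hp : 2 < p) {n : ℕ} (S : Finset (Fin n)) :
    ∃ y : Fin n → ℝ, (∀ i ∈ S, 0 < y i) ∧ (∀ i ∉ S, y i = 0) ∧
      (∀ i ∈ S, (gameA p n).mulVec y i = 1) ∧
      ∀ a : Fin n, (∀ s ∈ S, a < s) → 2 * p ^ ((a : ℕ) + 1) *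
        ∑ j : Fin n, p ^ ((j : ℕ) + 1) * y j < 1 := by
  induction S using Finset.induction_on_min with
  | empty => exact ⟨0, by simp, by simp, by simp, by simp⟩
  | insert a S ha ih =>
    obtain ⟨y, hpos, hzero, hone, hlt⟩ := ih
    have haS : a ∉ S := fun h => lt_irrefl a (ha a h)
    have hy0 : ∀ i, 0 ≤ y i := fun i => by
      by_cases h : i ∈ S
      · exact (hpos i h).le
      · exact (hzero i h).ge
    have hZ0 : 0 ≤ ∑ j : Fin n, p ^ ((j : ℕ) + 1) * y j :=
      Finset.sum_nonneg fun j _ => mul_nonneg (by positivity) (hy0 j)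
    have hZlt := hlt a ha
    have hq : 0 < p ^ ((a : ℕ) + 1) := by positivity
    set q := p ^ ((a : ℕ) + 1) with hqdef
    set Z := ∑ j : Fin n, p ^ ((j : ℕ) + 1) * y j with hZ
    set t := (1 / q - 2 * Z) / q with ht
    have hqt : q * t = 1 / q - 2 * Z := by rw [ht]; field_simp
    have hqq : q * (1 / q) = 1 := by field_simp
    have htpos : 0 < t := by
      apply div_pos _ hq
      rw [sub_pos, lt_div_iff₀ hq]
      linarith
    have htail : ∀ i, a ≤ i → ∑ j ∈ Finset.Ioi i, p ^ ((j : ℕ) + 1) * Function.update y a t j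
        = ∑ j ∈ Finset.Ioi i, p ^ ((j : ℕ) + 1) * y j := fun i hi =>
      Finset.sum_congr rfl fun j hj => by
        rw [Function.update_of_ne (hi.trans_lt (Finset.mem_Ioi.1 hj)).ne']
    refine ⟨Function.update y a t, fun i hi => ?_, fun i hi => ?_, fun i hi => ?_,
      fun b hb => ?_⟩
    · rcases Finset.mem_insert.1 hi with rfl | hi
      · simpa using htpos
      · rw [Function.update_of_ne (ha i hi).ne']
        exact hpos i hi
    · rw [Finset.mem_insert, not_or] at hi
      rw [Function.update_of_ne hi.1]
      exact hzero i hi.2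
    · rcases Finset.mem_insert.1 hi with rfl | hi
      · have hsum : ∑ j ∈ Finset.Ioi i, p ^ ((j : ℕ) + 1) * y j = Z := by
          refine Finset.sum_subset (Finset.subset_univ _) fun j _ hj => ?_
          rw [hzero j fun h => hj (Finset.mem_Ioi.2 (ha j h)), mul_zero]
        rw [gameA_mulVec, htail i le_rfl, hsum, Function.update_self, ← hqdef, hqt]
        linarith
      · rw [gameA_mulVec, htail i (ha i hi).le, Function.update_of_ne (ha i hi).ne',
          ← gameA_mulVec]
        exact hone i hi
    · have hsum : ∑ j : Fin n, p ^ ((j : ℕ) + 1) * Function.update y a t j = q * t + Z := by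
        rw [hZ, ← Finset.add_sum_erase _ _ (Finset.mem_univ a),
          ← Finset.add_sum_erase _ (fun j : Fin n => p ^ ((j : ℕ) + 1) * y j)
            (Finset.mem_univ a), Function.update_self, hzero a haS]
        simp only [mul_zero, zero_add]
        congr 1
        exact Finset.sum_congr rfl fun j hj => by
          rw [Function.update_of_ne (Finset.ne_of_mem_erase hj)]
      have hba : b < a := hb a (Finset.mem_insert_self _ _)
      have h2 := two_mul_pow_lt hp (show (b : ℕ) < a from hba)
      have hb0 : 0 < p ^ ((b : ℕ) + 1) := by positivity
      rw [hsum, hqt]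
      calc 2 * p ^ ((b : ℕ) + 1) * (1 / q - 2 * Z + Z)
          ≤ 2 * p ^ ((b : ℕ) + 1) * (1 / q) := by gcongr; linarith
        _ < q * (1 / q) := by gcongr
        _ = 1 := hqq

theorem stmt7 (p : ℝ) (hp : 2 < p) (n : ℕ) (hn : 0 < n) :
    (∀ x y : Fin n → ℝ, IsNash (gameA p n) (gameA p n)ᵀ x y → x = y) ∧
    (∀ S : Finset (Fin n), S.Nonempty →
      ∃! y : Fin n → ℝ,
        {j : Fin n | 0 < y j} = (S : Set (Fin n)) ∧
        IsNash (gameA p n) (gameA p n)ᵀ y y) := by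
  simp only [isNash_transpose_iff]
  refine ⟨?_, fun S ⟨m, hm⟩ => ?_⟩
  · rintro x y ⟨hx, hy, ⟨v, hv, hv'⟩, ⟨w, hw, hw'⟩⟩
    exact eq_of_gameA_mulVec_const hp hx hy
      (fun i => ⟨pos_of_gameA_best_response hp hy hv hv',
        pos_of_gameA_best_response hp hx hw hw'⟩) hv' hw'
  · obtain ⟨y, hpos, hzero, hone, -⟩ := exists_gameA_equalizing hp S
    have hy0 : ∀ i, 0 ≤ y i := fun i => by
      by_cases h : i ∈ S
      · exact (hpos i h).le
      · exact (hzero i h).ge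
    have hsupp : ∀ i, 0 < y i ↔ i ∈ S :=
      fun i => ⟨fun h => by_contra fun h' => h.ne' (hzero i h'), hpos i⟩
    have hs : 0 < ∑ i, y i :=
      Finset.sum_pos' (fun i _ => hy0 i) ⟨m, Finset.mem_univ m, hpos m hm⟩
    have hle : ∀ i, (gameA p n).mulVec y i ≤ 1 := fun i => by
      by_cases h : i ∈ S
      · exact (hone i h).le
      · obtain ⟨k, hk, hlt⟩ := exists_gameA_mulVec_lt hp hy0 (hpos m hm) (hzero i h)
        exact (hlt.trans_eq (hone k ((hsupp k).1 hk))).le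
    set c := (∑ i, y i)⁻¹ with hc
    have hc0 : 0 < c := inv_pos.2 hs
    have hmix : IsMixed (c • y) :=
      ⟨fun i => mul_nonneg hc0.le (hy0 i), by
        simp only [Pi.smul_apply, smul_eq_mul, ← Finset.mul_sum]
        exact inv_mul_cancel₀ hs.ne'⟩
    have hcsupp : ∀ i, 0 < (c • y) i ↔ i ∈ S := fun i => by
      rw [Pi.smul_apply, smul_eq_mul, mul_pos_iff_of_pos_left hc0, hsupp]
    have hA : ∀ i, (gameA p n).mulVec (c • y) i = c * (gameA p n).mulVec y i := fun i => by
      rw [Matrix.mulVec_smul, Pi.smul_apply, smul_eq_mul]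
    have hceq : ∀ i, 0 < (c • y) i → (gameA p n).mulVec (c • y) i = c := fun i hi => by
      rw [hA, hone i ((hcsupp i).1 hi), mul_one]
    have hbest : ∃ v, (∀ i, (gameA p n).mulVec (c • y) i ≤ v) ∧
        ∀ i, 0 < (c • y) i → (gameA p n).mulVec (c • y) i = v :=
      ⟨c, fun i => by rw [hA]; exact mul_le_of_le_one_right hc0.le (hle i), hceq⟩
    refine ⟨c • y, ⟨Set.ext hcsupp, hmix, hmix, hbest, hbest⟩, ?_⟩
    rintro z ⟨hzS, hz, -, ⟨v, -, hv⟩, -⟩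
    have hzc : ∀ i, 0 < z i ↔ 0 < (c • y) i := fun i =>
      (Set.ext_iff.1 hzS i).trans (hcsupp i).symm
    exact eq_of_gameA_mulVec_const hp hz hmix hzc (fun i hi => hceq i ((hzc i).1 hi))
      fun i hi => hv i ((hzc i).2 hi)
end

section
/- Let A be any n×n real matrix and suppose the bimatrix game (A, Aᵀ) is nondegenerate. Then (A, Aᵀ) has at most 2ⁿ − 1 symmetric Nash equilibria, i.e. Nash equilibria of the form (y, y); indeed, a symmetric Nash equilibrium is uniquely determined by the support of y, and there are 2ⁿ − 1 nonempty subsets of {1, …, n}. -/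
open Matrix BigOperators

theorem IsNash.le_of_pos {I J : Type*} [Fintype I] [Fintype J] {A B : Matrix I J ℝ}
    {x : I → ℝ} {y : J → ℝ} (h : IsNash A B x y) {i : I} (hi : 0 < x i) (k : I) :
    A.mulVec y k ≤ A.mulVec y i := by
  classical
  obtain ⟨⟨hx0, hx1⟩, -, hbest, -⟩ := h
  have hle : ∀ k, A.mulVec y k ≤ x ⬝ᵥ A.mulVec y := fun k => by
    have hk := hbest (Pi.single k 1)
      ⟨fun j => by by_cases hj : j = k <;> simp [hj], by simp⟩
    rwa [single_one_dotProduct] at hk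
  have hsum : ∑ j, x j * (x ⬝ᵥ A.mulVec y - A.mulVec y j) = 0 := by
    simp only [mul_sub, Finset.sum_sub_distrib, ← Finset.sum_mul, hx1, one_mul]
    exact sub_self _
  have hzero := (Finset.sum_eq_zero_iff_of_nonneg fun j _ =>
    mul_nonneg (hx0 j) (sub_nonneg.2 (hle j))).1 hsum i (Finset.mem_univ i)
  have := (mul_eq_zero.1 hzero).resolve_left hi.ne'
  linarith [hle k]

/-- If the best responses to `z` include a set `S` containing the support of `z`, then in a
nondegenerate game `S` is both the support of `z` and the set of best responses to `z`. -/
theorem Nondegenerate.support_eq_bestResponses {I : Type*} [Fintype I] {A B : Matrix I I ℝ}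
    (hA : Nondegenerate A B) {S : Set I} {z : I → ℝ} (hz : IsMixed z)
    (hzS : {j | 0 < z j} ⊆ S) (hS : S ⊆ {i | ∀ k, A.mulVec z k ≤ A.mulVec z i}) :
    {j | 0 < z j} = S ∧ {i | ∀ k, A.mulVec z k ≤ A.mulVec z i} = S := by
  have hcard := hA.1 z hz
  have h₁ := Set.ncard_le_ncard hzS
  have h₂ := Set.ncard_le_ncard hS
  exact ⟨Set.eq_of_subset_of_ncard_le hzS (by omega),
    (Set.eq_of_subset_of_ncard_le hS (by omega)).symm⟩

/-- In a nondegenerate game, a symmetric equilibrium is determined by its support: the line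
through two equilibria with common support `S` would meet the closed conditions "nonnegative, with
all of `S` best responses" in a nonempty clopen set, so would consist of mixed strategies. -/
theorem Nondegenerate.eq_of_support_eq {I : Type*} [Fintype I] {A B : Matrix I I ℝ}
    (hA : Nondegenerate A B) {y y' : I → ℝ} (hy : IsNash A B y y) (hy' : IsNash A B y' y')
    (hsupp : {j | 0 < y j} = {j | 0 < y' j}) : y = y' := by
  have hiff : ∀ j, 0 < y j ↔ 0 < y' j := fun j => Set.ext_iff.1 hsupp j
  set z : ℝ → I → ℝ := fun t => y + t • (y' - y) with hz
  have hzi : ∀ i, Continuous fun t => z t i := fun i => by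
    simp only [hz, Pi.add_apply, Pi.smul_apply]; fun_prop
  have hAz : ∀ t i, A.mulVec (z t) i =
      A.mulVec y i + t * (A.mulVec y' i - A.mulVec y i) := fun t i => by
    simp [hz, mulVec_add, mulVec_smul, mulVec_sub]
  have hAzi : ∀ i, Continuous fun t => A.mulVec (z t) i := fun i => by
    simp only [hAz]; fun_prop
  have hsum : ∀ t, ∑ i, z t i = 1 := fun t => by
    simp [hz, Finset.sum_add_distrib, ← Finset.mul_sum, hy.1.2, hy'.1.2]
  have hoff : ∀ t i, ¬ 0 < y i → z t i = 0 := fun t i hi => by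
    have h := le_antisymm (not_lt.1 hi) (hy.1.1 i)
    have h' := le_antisymm (not_lt.1 (mt (hiff i).2 hi)) (hy'.1.1 i)
    simp [hz, h, h']
  have hconst : ∀ t i j, 0 < y i → 0 < y j → A.mulVec (z t) i = A.mulVec (z t) j :=
    fun t i j hi hj => by
      rw [hAz, hAz, le_antisymm (hy.le_of_pos hj i) (hy.le_of_pos hi j),
        le_antisymm (hy'.le_of_pos ((hiff j).1 hj) i) (hy'.le_of_pos ((hiff i).1 hi) j)]
  set T : Set ℝ := {t | (∀ i, 0 ≤ z t i) ∧
    ∀ i, 0 < y i → ∀ k, A.mulVec (z t) k ≤ A.mulVec (z t) i} with hT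
  have hclosed : IsClosed T := by
    simp only [hT, Set.ofPred_and, Set.ofPred_forall]
    exact (isClosed_iInter fun i => isClosed_le continuous_const (hzi i)).inter
      (isClosed_iInter fun i => isClosed_iInter fun _ => isClosed_iInter fun k =>
        isClosed_le (hAzi k) (hAzi i))
  have hstrict : T = {t | (∀ i, 0 < y i → 0 < z t i) ∧
      ∀ i, 0 < y i → ∀ k, ¬ 0 < y k → A.mulVec (z t) k < A.mulVec (z t) i} := by
    ext t
    constructor
    · rintro ⟨h0, hbest⟩
      obtain ⟨hS, hBR⟩ := hA.support_eq_bestResponses (S := {j | 0 < y j}) ⟨h0, hsum t⟩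
        (fun j hj => by_contra fun h => (hoff t j h).not_gt hj) hbest
      refine ⟨fun i hi => hS.ge hi, fun i hi k hk => lt_of_not_ge fun hle => hk ?_⟩
      exact hBR.le fun l => (hbest i hi l).trans hle
    · rintro ⟨h0, hbest⟩
      refine ⟨fun i => ?_, fun i hi k => ?_⟩
      · by_cases hi : 0 < y i
        · exact (h0 i hi).le
        · exact (hoff t i hi).ge
      · by_cases hk : 0 < y k
        · exact (hconst t k i hk hi).le
        · exact (hbest i hi k hk).le
  have hopen : IsOpen T := by
    simp only [hstrict, Set.ofPred_and, Set.ofPred_forall]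
    exact (isOpen_iInter_of_finite fun i => isOpen_iInter_of_finite fun _ =>
      isOpen_lt continuous_const (hzi i)).inter
      (isOpen_iInter_of_finite fun i => isOpen_iInter_of_finite fun _ =>
        isOpen_iInter_of_finite fun k => isOpen_iInter_of_finite fun _ =>
          isOpen_lt (hAzi k) (hAzi i))
  have hzero : (0 : ℝ) ∈ T := by
    refine ⟨fun i => ?_, fun i hi k => ?_⟩
    · simpa [hz] using hy.1.1 i
    · simpa [hz] using hy.le_of_pos hi k
  have huniv : T = Set.univ := IsClopen.eq_univ ⟨hclosed, hopen⟩ ⟨0, hzero⟩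
  funext i
  by_contra hne
  have hd : y' i - y i ≠ 0 := sub_ne_zero.2 (Ne.symm hne)
  have hneg := (huniv.ge (Set.mem_univ (-(y i + 1) / (y' i - y i)))).1 i
  simp only [hz, Pi.add_apply, Pi.smul_apply, Pi.sub_apply, smul_eq_mul,
    div_mul_cancel₀ _ hd] at hneg
  linarith

theorem stmt8 (n : ℕ) (A : Matrix (Fin n) (Fin n) ℝ)
    (hA : Nondegenerate A Aᵀ) :
    {y : Fin n → ℝ | IsNash A Aᵀ y y}.Finite ∧
    {y : Fin n → ℝ | IsNash A Aᵀ y y}.ncard ≤ 2 ^ n - 1 ∧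
    (∀ y y' : Fin n → ℝ, IsNash A Aᵀ y y → IsNash A Aᵀ y' y' →
      {j : Fin n | 0 < y j} = {j : Fin n | 0 < y' j} → y = y') := by
  have hinj : Set.InjOn (fun y : Fin n → ℝ => {j | 0 < y j}) {y | IsNash A Aᵀ y y} :=
    fun y hy y' hy' h => hA.eq_of_support_eq hy hy' h
  have hmaps : Set.MapsTo (fun y : Fin n → ℝ => {j | 0 < y j}) {y | IsNash A Aᵀ y y}
      ({∅}ᶜ : Set (Set (Fin n))) := fun y hy hempty => by
    have hnonpos : ∀ j, ¬ 0 < y j := Set.eq_empty_iff_forall_notMem.1 hempty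
    linarith [hy.1.2, Finset.sum_nonpos fun j (_ : j ∈ Finset.univ) => not_lt.1 (hnonpos j)]
  refine ⟨Set.Finite.of_injOn hmaps hinj (Set.toFinite _), ?_,
    fun y y' hy hy' h => hinj hy hy' h⟩
  calc {y : Fin n → ℝ | IsNash A Aᵀ y y}.ncard
      ≤ ({∅}ᶜ : Set (Set (Fin n))).ncard := Set.ncard_le_ncard_of_injOn _ hmaps hinj
    _ = 2 ^ n - 1 := by
        rw [Set.ncard_compl, Set.ncard_singleton, Nat.card_eq_fintype_card, Fintype.card_set,
          Fintype.card_fin]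
end

section
/- Let (A, B) be a nondegenerate m×n bimatrix game. If (x, y) and (x', y') are Nash equilibria of (A, B) with equal support pairs, i.e. supp(x) = supp(x') and supp(y) = supp(y'), then (x, y) = (x', y'). -/
open Matrix BigOperators

/-- A finite family of affine functions, positive at `0` and not all nondecreasing, has a first
positive time at which one of them vanishes. -/
theorem exists_first_zero_of_affine {ι : Type*} [Finite ι] (a b : ι → ℝ)
    (ha : ∀ c, 0 < a c) (hb : ∃ c, b c < 0) :
    ∃ t : ℝ, (∀ c, 0 ≤ a c + t * b c) ∧ ∃ c, a c + t * b c = 0 := by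
  obtain ⟨c₀, hc₀⟩ := hb
  obtain ⟨c, hc, hmin⟩ := Set.exists_min_image {c | b c < 0} (fun c => a c / -b c)
    (Set.toFinite _) ⟨c₀, hc₀⟩
  have hc : b c < 0 := hc
  refine ⟨a c / -b c, fun d => ?_, c, by rw [div_neg, neg_mul, div_mul_cancel₀ _ hc.ne, add_neg_cancel]⟩
  rcases lt_or_ge (b d) 0 with hd | hd
  · have := (le_div_iff₀ (neg_pos.2 hd)).1 (hmin d hd)
    linarith
  · have := (div_pos (ha c) (neg_pos.2 hc)).le
    have := ha d
    positivity

/-- Pure strategies in the support of an optimal mixed strategy are pure best responses. -/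
theorem IsMixed.le_of_pos_of_optimal {I : Type*} [Fintype I] {x w : I → ℝ} (hx : IsMixed x)
    (hopt : ∀ x' : I → ℝ, IsMixed x' → x' ⬝ᵥ w ≤ x ⬝ᵥ w) {i : I} (hi : 0 < x i) (k : I) :
    w k ≤ w i := by
  classical
  have hw : ∀ k, w k ≤ x ⬝ᵥ w := fun k => by
    have hk : IsMixed (Pi.single k (1 : ℝ)) :=
      ⟨fun j => by by_cases hj : j = k <;> simp [hj], by simp⟩
    simpa using hopt _ hk
  have hsum : ∑ j, x j * (x ⬝ᵥ w - w j) = 0 := by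
    simp only [mul_sub, Finset.sum_sub_distrib, ← Finset.sum_mul, hx.2]
    simp [dotProduct]
  have hzero := (Finset.sum_eq_zero_iff_of_nonneg fun j _ =>
    mul_nonneg (hx.1 j) (sub_nonneg.2 (hw j))).1 hsum i (Finset.mem_univ i)
  have := (mul_eq_zero.1 hzero).resolve_left hi.ne'
  linarith [hw k]

/-- In a nondegenerate game, a mixed strategy is determined by its support and a set of pure best
responses to it of the same size as the support. -/
theorem IsMixed.eq_of_support_eq_of_bestResponses {I J : Type*} [Fintype I] [Fintype J]
    {A : Matrix I J ℝ}
    (hA : ∀ y : J → ℝ, IsMixed y →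
      {i : I | ∀ k, A.mulVec y k ≤ A.mulVec y i}.ncard ≤ {j : J | 0 < y j}.ncard)
    {y y' : J → ℝ} (hy : IsMixed y) (hy' : IsMixed y')
    (hsupp : {j : J | 0 < y j} = {j : J | 0 < y' j}) {S : Set I}
    (hS : ∀ i ∈ S, ∀ k, A.mulVec y k ≤ A.mulVec y i)
    (hS' : ∀ i ∈ S, ∀ k, A.mulVec y' k ≤ A.mulVec y' i)
    (hcard : S.ncard = {j : J | 0 < y j}.ncard) : y = y' := by
  by_contra hne
  have hpos : ∀ j, 0 < y j ↔ 0 < y' j := fun j => Set.ext_iff.1 hsupp j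
  have hSeq : S = {i : I | ∀ k, A.mulVec y k ≤ A.mulVec y i} :=
    Set.eq_of_subset_of_ncard_le hS (hcard ▸ hA y hy)
  have hdsum : ∑ j, (y j - y' j) = 0 := by
    rw [Finset.sum_sub_distrib, hy.2, hy'.2, sub_self]
  obtain ⟨j₀, hj₀⟩ : ∃ j, y j - y' j < 0 := by
    by_contra! hnn
    have := (Finset.sum_eq_zero_iff_of_nonneg fun j _ => hnn j).1 hdsum
    exact hne (funext fun j => sub_eq_zero.1 (this j (Finset.mem_univ j)))
  have hyj₀ : 0 < y j₀ := (hpos j₀).2 (by linarith [hy.1 j₀])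
  obtain ⟨i₀, hi₀⟩ : S.Nonempty := by
    rw [← Set.ncard_pos, hcard, Set.ncard_pos]
    exact ⟨j₀, hyj₀⟩
  have hlt : ∀ k ∉ S, A.mulVec y k < A.mulVec y i₀ := fun k hk => by
    by_contra! hle
    exact hk (hSeq ▸ fun l => (hS i₀ hi₀ l).trans hle)
  obtain ⟨t, hnonneg, hzero⟩ := exists_first_zero_of_affine
    (ι := {j : J // 0 < y j} ⊕ {k : I // k ∉ S})
    (Sum.elim (fun j => y j) fun k => A.mulVec y i₀ - A.mulVec y k)
    (Sum.elim (fun j => y j - y' j)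
      fun k => (A.mulVec y i₀ - A.mulVec y' i₀) - (A.mulVec y k - A.mulVec y' k))
    (by rintro (j | k)
        · exact j.2
        · exact sub_pos.2 (hlt k k.2))
    ⟨Sum.inl ⟨j₀, hyj₀⟩, hj₀⟩
  obtain ⟨z, hz⟩ : ∃ z : J → ℝ, z = y + t • (y - y') := ⟨_, rfl⟩
  have hzj : ∀ j, z j = y j + t * (y j - y' j) := fun j => by simp [hz]
  have hAz : ∀ k, A.mulVec z k =
      A.mulVec y k + t * (A.mulVec y k - A.mulVec y' k) := fun k => by
    simp [hz, Matrix.mulVec_add, Matrix.mulVec_smul, Matrix.mulVec_sub]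
  have hoff : ∀ j, ¬ 0 < y j → z j = 0 := fun j hj => by
    have h₁ := le_antisymm (not_lt.1 hj) (hy.1 j)
    have h₂ := le_antisymm (not_lt.1 fun h => hj ((hpos j).2 h)) (hy'.1 j)
    simp [hzj, h₁, h₂]
  have hzmixed : IsMixed z := by
    refine ⟨fun j => ?_, ?_⟩
    · by_cases hj : 0 < y j
      · simpa [hzj] using hnonneg (Sum.inl ⟨j, hj⟩)
      · exact (hoff j hj).ge
    · simp only [hzj, Finset.sum_add_distrib, ← Finset.mul_sum, hdsum, hy.2]
      simp
  have hzS : ∀ i ∈ S, A.mulVec z i = A.mulVec z i₀ := fun i hi => by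
    rw [hAz, hAz, le_antisymm (hS i₀ hi₀ i) (hS i hi i₀),
      le_antisymm (hS' i₀ hi₀ i) (hS' i hi i₀)]
  have hmax : ∀ k, A.mulVec z k ≤ A.mulVec z i₀ := fun k => by
    by_cases hk : k ∈ S
    · exact (hzS k hk).le
    · have := hnonneg (Sum.inr ⟨k, hk⟩)
      simp only [Sum.elim_inr] at this
      rw [hAz, hAz]
      linarith
  have hSz : S ⊆ {i : I | ∀ k, A.mulVec z k ≤ A.mulVec z i} := fun i hi k =>
    (hmax k).trans (hzS i hi).ge
  have hsuppz : {j : J | 0 < z j} ⊆ {j : J | 0 < y j} := fun j hj => by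
    by_contra h
    exact (show 0 < z j from hj).ne' (hoff j h)
  have hAcard := hA z hzmixed
  obtain ⟨⟨j, hj⟩ | ⟨k, hk⟩, hc⟩ := hzero
  · simp only [Sum.elim_inl, ← hzj] at hc
    have hss : {j : J | 0 < z j} ⊂ {j : J | 0 < y j} :=
      (Set.ssubset_iff_of_subset hsuppz).2 ⟨j, hj, by simp [hc]⟩
    have h₁ := Set.ncard_lt_ncard hss
    have h₂ := Set.ncard_le_ncard hSz
    omega
  · simp only [Sum.elim_inr] at hc
    have hkz : A.mulVec z k = A.mulVec z i₀ := by
      rw [hAz, hAz]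
      linarith
    have hss : S ⊂ {i : I | ∀ k, A.mulVec z k ≤ A.mulVec z i} :=
      (Set.ssubset_iff_of_subset hSz).2 ⟨k, fun l => (hmax l).trans hkz.ge, hk⟩
    have h₁ := Set.ncard_lt_ncard hss
    have h₂ := Set.ncard_le_ncard hsuppz
    omega

section Nash

variable {I J : Type*} [Fintype I] [Fintype J] {A B : Matrix I J ℝ} {x : I → ℝ} {y : J → ℝ}

theorem IsNash.row_bestResponse (h : IsNash A B x y) {i : I} (hi : 0 < x i) (k : I) :
    A.mulVec y k ≤ A.mulVec y i :=
  h.1.le_of_pos_of_optimal h.2.2.1 hi k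

theorem IsNash.column_bestResponse (h : IsNash A B x y) {j : J} (hj : 0 < y j) (k : J) :
    Bᵀ.mulVec x k ≤ Bᵀ.mulVec x j := by
  refine h.2.1.le_of_pos_of_optimal (fun y' hy' => ?_) hj k
  have hcomm : ∀ z : J → ℝ, z ⬝ᵥ Bᵀ.mulVec x = x ⬝ᵥ B.mulVec z := fun z => by
    rw [Matrix.mulVec_transpose, dotProduct_comm, Matrix.dotProduct_mulVec]
  rw [hcomm, hcomm]
  exact h.2.2.2 y' hy'

/-- Equilibrium strategies of a nondegenerate game have supports of equal size. -/
theorem IsNash.ncard_support_eq (h : IsNash A B x y) (hAB : Nondegenerate A B) :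
    {i : I | 0 < x i}.ncard = {j : J | 0 < y j}.ncard :=
  le_antisymm
    ((Set.ncard_le_ncard fun _ hi => h.row_bestResponse hi).trans (hAB.1 y h.2.1))
    ((Set.ncard_le_ncard fun _ hj => h.column_bestResponse hj).trans (hAB.2 x h.1))

end Nash

theorem stmt9 (m n : ℕ) (A B : Matrix (Fin m) (Fin n) ℝ)
    (hAB : Nondegenerate A B)
    (x x' : Fin m → ℝ) (y y' : Fin n → ℝ)
    (h : IsNash A B x y) (h' : IsNash A B x' y')
    (hx : {i : Fin m | 0 < x i} = {i : Fin m | 0 < x' i})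
    (hy : {j : Fin n | 0 < y j} = {j : Fin n | 0 < y' j}) :
    x = x' ∧ y = y' := by
  have hcard := h.ncard_support_eq hAB
  refine ⟨IsMixed.eq_of_support_eq_of_bestResponses hAB.2 h.1 h'.1 hx
      (S := {j | 0 < y j}) (fun j hj => h.column_bestResponse hj) (fun j hj => ?_) hcard.symm,
    IsMixed.eq_of_support_eq_of_bestResponses hAB.1 h.2.1 h'.2.1 hy
      (S := {i | 0 < x i}) (fun i hi => h.row_bestResponse hi) (fun i hi => ?_) hcard⟩
  · rw [hy] at hj
    exact h'.column_bestResponse hj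
  · rw [hx] at hi
    exact h'.row_bestResponse hi
end

section
/- Let (A, B) be an n×n bimatrix game in which all entries of A and B are positive, and let C be the 2n×2n block matrix C = [[0, A],[Bᵀ, 0]]. For any two Nash equilibria (x, y) and (x', y') of (A, B), there exist real numbers λ, μ ∈ (0, 1) such that the pair of mixed strategies (z, w) for the game (C, Cᵀ), given by z = (λ x, (1 − λ) y') and w = (μ x', (1 − μ) y) (concatenations of scaled vectors in ℝ²ⁿ), is a Nash equilibrium of (C, Cᵀ). -/
open Matrix BigOperators

theorem IsMixed.single {I : Type*} [Fintype I] [DecidableEq I] (i : I) :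
    IsMixed (Pi.single i 1 : I → ℝ) := by
  refine ⟨fun j => ?_, by simp⟩
  by_cases h : j = i
  · subst h; simp
  · simp [h]

theorem IsMixed.sumElim {I J : Type*} [Fintype I] [Fintype J] {x : I → ℝ} {y : J → ℝ}
    (hx : IsMixed x) (hy : IsMixed y) {t : ℝ} (ht : t ∈ Set.Ioo (0 : ℝ) 1) :
    IsMixed (Sum.elim (fun i => t * x i) (fun j => (1 - t) * y j)) := by
  refine ⟨?_, ?_⟩
  · rintro (i | j)
    · exact mul_nonneg ht.1.le (hx.1 i)
    · exact mul_nonneg (sub_nonneg.2 ht.2.le) (hy.1 j)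
  · simp [Fintype.sum_sum_type, ← Finset.mul_sum, hx.2, hy.2]

theorem IsMixed.dotProduct_le {I : Type*} [Fintype I] {s f : I → ℝ} {c : ℝ} (hs : IsMixed s)
    (hf : ∀ i, f i ≤ c) : s ⬝ᵥ f ≤ c :=
  calc s ⬝ᵥ f ≤ ∑ i, s i * c :=
        Finset.sum_le_sum fun i _ => mul_le_mul_of_nonneg_left (hf i) (hs.1 i)
    _ = c := by rw [← Finset.sum_mul, hs.2, one_mul]

theorem IsMixed.dotProduct_pos {I : Type*} [Fintype I] {s f : I → ℝ} (hs : IsMixed s)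
    (hf : ∀ i, 0 < f i) : 0 < s ⬝ᵥ f := by
  refine Finset.sum_pos' (fun i _ => mul_nonneg (hs.1 i) (hf i).le) ?_
  by_contra! hle
  have hzero : ∑ i, s i ≤ 0 := Finset.sum_nonpos fun i hi => by
    by_contra! hpos
    exact (hle i hi).not_gt (mul_pos hpos (hf i))
  linarith [hs.2]

theorem IsMixed.payoff_pos {I J : Type*} [Fintype I] [Fintype J] {A : Matrix I J ℝ}
    (hA : ∀ i j, 0 < A i j) {x : I → ℝ} {y : J → ℝ} (hx : IsMixed x) (hy : IsMixed y) :
    0 < x ⬝ᵥ A *ᵥ y :=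
  hx.dotProduct_pos fun i => by
    rw [mulVec, dotProduct_comm]
    exact hy.dotProduct_pos (hA i)

theorem IsNash.mulVec_le {I J : Type*} [Fintype I] [Fintype J] {A B : Matrix I J ℝ}
    {x : I → ℝ} {y : J → ℝ} (h : IsNash A B x y) (i : I) : (A *ᵥ y) i ≤ x ⬝ᵥ A *ᵥ y := by
  classical
  simpa using h.2.2.1 _ (IsMixed.single i)

theorem IsNash.transpose_mulVec_le {I J : Type*} [Fintype I] [Fintype J] {A B : Matrix I J ℝ}
    {x : I → ℝ} {y : J → ℝ} (h : IsNash A B x y) (j : J) :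
    (Bᵀ *ᵥ x) j ≤ x ⬝ᵥ B *ᵥ y := by
  classical
  have hj := h.2.2.2 _ (IsMixed.single j)
  rwa [dotProduct_mulVec, dotProduct_single_one, ← mulVec_transpose] at hj

/-- If `t` equalizes the scaled equilibrium payoffs, then every mixture of the equilibrium
strategies `x` and `y'` is a best reply in the block game to `(t x', (1 - t) y)`. -/
theorem IsNash.fromBlocks_best_reply {I J : Type*} [Fintype I] [Fintype J] {A B : Matrix I J ℝ}
    {x x' : I → ℝ} {y y' : J → ℝ} (h : IsNash A B x y) (h' : IsNash A B x' y')
    {t : ℝ} (ht : t ∈ Set.Ioo (0 : ℝ) 1)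
    (heq : (1 - t) * (x ⬝ᵥ A *ᵥ y) = t * (x' ⬝ᵥ B *ᵥ y')) (r : ℝ)
    {s : I ⊕ J → ℝ} (hs : IsMixed s) :
    s ⬝ᵥ fromBlocks 0 A Bᵀ 0 *ᵥ Sum.elim (fun i => t * x' i) (fun j => (1 - t) * y j) ≤
      Sum.elim (fun i => r * x i) (fun j => (1 - r) * y' j) ⬝ᵥ
        fromBlocks 0 A Bᵀ 0 *ᵥ Sum.elim (fun i => t * x' i) (fun j => (1 - t) * y j) := by
  have hw : fromBlocks 0 A Bᵀ 0 *ᵥ Sum.elim (fun i => t * x' i) (fun j => (1 - t) * y j) =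
      Sum.elim ((1 - t) • A *ᵥ y) (t • Bᵀ *ᵥ x') := by
    rw [fromBlocks_mulVec, Sum.elim_comp_inl, Sum.elim_comp_inr, zero_mulVec, zero_mulVec,
      zero_add, add_zero, ← mulVec_smul, ← mulVec_smul]
    rfl
  have hz : Sum.elim (fun i => r * x i) (fun j => (1 - r) * y' j) ⬝ᵥ
      Sum.elim ((1 - t) • A *ᵥ y) (t • Bᵀ *ᵥ x') = (1 - t) * (x ⬝ᵥ A *ᵥ y) := by
    change Sum.elim (r • x) ((1 - r) • y') ⬝ᵥ _ = _
    rw [sumElim_dotProduct_sumElim, smul_dotProduct, smul_dotProduct, dotProduct_smul,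
      dotProduct_smul, mulVec_transpose, dotProduct_comm y', ← dotProduct_mulVec]
    simp only [smul_eq_mul]
    rw [← heq]
    ring
  rw [hw, hz]
  refine hs.dotProduct_le ?_
  rintro (i | j)
  · exact mul_le_mul_of_nonneg_left (h.mulVec_le i) (sub_nonneg.2 ht.2.le)
  · rw [heq]
    exact mul_le_mul_of_nonneg_left (h'.transpose_mulVec_le j) ht.1.le

theorem exists_mem_Ioo_one_sub_mul_eq {u v : ℝ} (hu : 0 < u) (hv : 0 < v) :
    ∃ t ∈ Set.Ioo (0 : ℝ) 1, (1 - t) * u = t * v := by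
  refine ⟨u / (u + v), ⟨by positivity, ?_⟩, ?_⟩
  · rw [div_lt_one (by positivity)]
    linarith
  · field_simp
    ring

theorem stmt10 (n : ℕ) (A B : Matrix (Fin n) (Fin n) ℝ)
    (hA : ∀ i j, 0 < A i j) (hB : ∀ i j, 0 < B i j)
    (x x' y y' : Fin n → ℝ)
    (h : IsNash A B x y) (h' : IsNash A B x' y') :
    ∃ lam mu : ℝ, lam ∈ Set.Ioo (0 : ℝ) 1 ∧ mu ∈ Set.Ioo (0 : ℝ) 1 ∧
      IsNash (Matrix.fromBlocks 0 A Bᵀ 0) (Matrix.fromBlocks 0 A Bᵀ 0)ᵀ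
        (Sum.elim (fun i => lam * x i) (fun j => (1 - lam) * y' j))
        (Sum.elim (fun i => mu * x' i) (fun j => (1 - mu) * y j)) := by
  obtain ⟨mu, hmu, hmu_eq⟩ := exists_mem_Ioo_one_sub_mul_eq
    (h.1.payoff_pos hA h.2.1) (h'.1.payoff_pos hB h'.2.1)
  obtain ⟨lam, hlam, hlam_eq⟩ := exists_mem_Ioo_one_sub_mul_eq
    (h'.1.payoff_pos hA h'.2.1) (h.1.payoff_pos hB h.2.1)
  refine ⟨lam, mu, hlam, hmu, h.1.sumElim h'.2.1 hlam, h'.1.sumElim h.2.1 hmu,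
    fun s hs => h.fromBlocks_best_reply h' hmu hmu_eq lam hs, fun s hs => ?_⟩
  rw [dotProduct_mulVec, dotProduct_mulVec, vecMul_transpose, dotProduct_comm,
    dotProduct_comm (_ *ᵥ _)]
  exact h'.fromBlocks_best_reply h hlam hlam_eq mu hs
end

section
/- Let p be a real number with p > 2 and let n be a positive integer. Let A be the n×n real matrix with entries a_{ij} = 2p^{i+j} if j > i, a_{ij} = p^{2i} if j = i, and a_{ij} = 0 if j < i. Let y be a mixed strategy with support S, let i ∉ S, and suppose T = {j ∈ S : j > i} is nonempty with t = min T. Then a_{ij} < a_{tj} for every j ∈ T, and consequently (Ay)_i < (Ay)_t. -/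
open Matrix BigOperators

/-- Within a column, entries on or above the diagonal strictly increase with the row. -/
theorem gameA_lt_gameA {p : ℝ} (hp : 2 < p) {n : ℕ} {i t j : Fin n} (hit : i < t) (htj : t ≤ j) :
    gameA p n i j < gameA p n t j := by
  have hp1 : 1 < p := by linarith
  have hit' : (i : ℕ) < t := hit
  have hij : (i : ℕ) < j := hit.trans_le htj
  rcases htj.lt_or_eq with h | rfl
  · have h' : (t : ℕ) < j := h
    simp only [gameA, if_pos hij, if_pos h']
    gcongr
  · simp only [gameA, if_pos hij, lt_irrefl, if_true, if_false]
    calc 2 * p ^ ((i : ℕ) + 1 + (t + 1)) < p * p ^ ((i : ℕ) + 1 + (t + 1)) := by gcongr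
      _ = p ^ ((i : ℕ) + 1 + (t + 1) + 1) := (pow_succ' _ _).symm
      _ ≤ p ^ (2 * ((t : ℕ) + 1)) := pow_le_pow_right₀ hp1.le (by omega)

theorem stmt12 (p : ℝ) (hp : 2 < p) (n : ℕ) (hn : 0 < n)
    (y : Fin n → ℝ) (hy : IsMixed y) (i : Fin n) (hi : ¬ 0 < y i)
    (T : Finset (Fin n)) (hT : T = Finset.univ.filter (fun j => 0 < y j ∧ i < j))
    (hTne : T.Nonempty) :
    (∀ j ∈ T, gameA p n i j < gameA p n (T.min' hTne) j) ∧
    (gameA p n).mulVec y i < (gameA p n).mulVec y (T.min' hTne) := by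
  have hmem : ∀ j, j ∈ T ↔ 0 < y j ∧ i < j := by simp [hT]
  have hminT := T.min'_mem hTne
  obtain ⟨hpos, hlt⟩ := (hmem _).1 hminT
  have hcol : ∀ j ∈ T, gameA p n i j < gameA p n (T.min' hTne) j := fun j hj =>
    gameA_lt_gameA hp hlt (T.min'_le j hj)
  refine ⟨hcol, ?_⟩
  simp only [mulVec, dotProduct]
  refine Finset.sum_lt_sum (fun j _ => ?_)
    ⟨T.min' hTne, Finset.mem_univ _, mul_lt_mul_of_pos_right (hcol _ hminT) hpos⟩
  rcases (hy.1 j).eq_or_lt with hj0 | hj0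
  · simp [← hj0]
  rcases lt_trichotomy j i with hji | rfl | hij
  · rw [gameA_eq_zero_of_lt p hji, gameA_eq_zero_of_lt p (hji.trans hlt)]
  · exact absurd hj0 hi
  · exact mul_le_mul_of_nonneg_right (hcol j ((hmem j).2 ⟨hj0, hij⟩)).le hj0.le
end
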